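/- There exists a group homomorphism ψ̂ : Ŝ → ℤ such that ψ̂(x_s) = 0 for every s ∈ {0,1}^{<ℕ}, ψ̂(p_n) = 0 for every n ≥ 0, and ψ̂(y_s) = 1 for every s ∈ {0,1}^{<ℕ}; in particular Thompson's group T lies in the kernel of ψ̂. -/

import Mathlib

/-- The Cantor set of infinite binary sequences. -/
abbrev Cantor : Type := ℕ → Bool

/-- Concatenation of a finite binary sequence with an infinite binary sequence. -/
def cat (s : List Bool) (η : Cantor) : Cantor :=
  fun n => if h : n < s.length then s.get ⟨n, h⟩ else η (n - s.length)

/-- `s` is a (finite) prefix of the infinite sequence `ξ`. -/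
def IsPrefixOf (s : List Bool) (ξ : Cantor) : Prop := ∃ η : Cantor, ξ = cat s η

/-- The group of self-homeomorphisms of a topological space, with
`(f * g) ξ = f (g ξ)` (i.e. in the right-action convention `ξ·(g h) = (ξ·g)·h`,
the product `g * f` corresponds to the word "apply `f`, then `g`"). -/
instance {α : Type*} [TopologicalSpace α] : Group (α ≃ₜ α) where
  mul f g := g.trans f
  one := Homeomorph.refl α
  inv := Homeomorph.symm
  mul_assoc _ _ _ := Homeomorph.ext fun _ => rfl
  one_mul _ := Homeomorph.ext fun _ => rfl
  mul_one _ := Homeomorph.ext fun _ => rfl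
  inv_mul_cancel f := Homeomorph.ext fun ξ => f.symm_apply_apply ξ

@[simp] lemma homeo_mul_apply {α : Type*} [TopologicalSpace α] (f g : α ≃ₜ α) (ξ : α) :
    (f * g) ξ = f (g ξ) := rfl

@[simp] lemma homeo_one_apply {α : Type*} [TopologicalSpace α] (ξ : α) :
    (1 : α ≃ₜ α) ξ = ξ := rfl

@[simp] lemma homeo_inv_apply {α : Type*} [TopologicalSpace α] (f : α ≃ₜ α) (ξ : α) :
    (f⁻¹ : α ≃ₜ α) ξ = f.symm ξ := rfl

/-- The data of the basic homeomorphisms `x`, `y`, `x_s`, `y_s`, `p_n` of the Cantor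
set, together with their recursive defining equations. -/
structure LMData where
  x : Cantor ≃ₜ Cantor
  y : Cantor ≃ₜ Cantor
  xx : List Bool → Cantor ≃ₜ Cantor
  yy : List Bool → Cantor ≃ₜ Cantor
  p : ℕ → Cantor ≃ₜ Cantor
  hx00 : ∀ η, x (cat [false, false] η) = cat [false] η
  hx01 : ∀ η, x (cat [false, true] η) = cat [true, false] η
  hx1 : ∀ η, x (cat [true] η) = cat [true, true] η
  hy00 : ∀ η, y (cat [false, false] η) = cat [false] (y η)
  hy01 : ∀ η, y (cat [false, true] η) = cat [true, false] (y.symm η)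
  hy1 : ∀ η, y (cat [true] η) = cat [true, true] (y η)
  hxx : ∀ s η, xx s (cat s η) = cat s (x η)
  hxx' : ∀ s ξ, ¬ IsPrefixOf s ξ → xx s ξ = ξ
  hyy : ∀ s η, yy s (cat s η) = cat s (y η)
  hyy' : ∀ s ξ, ¬ IsPrefixOf s ξ → yy s ξ = ξ
  hp1 : ∀ n k η, k < n → p n (cat (List.replicate k true ++ [false]) η) =
      cat (List.replicate (k + 1) true ++ [false]) η
  hp2 : ∀ n η, p n (cat (List.replicate n true ++ [false]) η) =
      cat (List.replicate (n + 1) true) η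
  hp3 : ∀ n η, p n (cat (List.replicate (n + 1) true) η) = cat [false] η

/-- Thompson's group `T`, generated by all `x_s` and all `p_n`. -/
def Tgrp (D : LMData) : Subgroup (Cantor ≃ₜ Cantor) :=
  Subgroup.closure (Set.range D.xx ∪ Set.range D.p)

/-- The group `Ŝ`, generated by all `x_s`, all `y_s` and all `p_n`. -/
def Shat (D : LMData) : Subgroup (Cantor ≃ₜ Cantor) :=
  Subgroup.closure (Set.range D.xx ∪ Set.range D.yy ∪ Set.range D.p)

/-- The homeomorphism `y₁₀ y₁₁₀⁻¹` (right-action word: first `y₁₀`, then `y₁₁₀⁻¹`). -/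
def sgen (D : LMData) : Cantor ≃ₜ Cantor :=
  (D.yy [true, true, false])⁻¹ * D.yy [true, false]

/-- The group `S`, generated by Thompson's group `T` together with `y₁₀ y₁₁₀⁻¹`. -/
def Sgrp (D : LMData) : Subgroup (Cantor ≃ₜ Cantor) :=
  Subgroup.closure (↑(Tgrp D) ∪ {sgen D})

/-- The Lodha–Moore group `_yG_y`, generated by all `x_s` and all `y_s`. -/
def LMgrp (D : LMData) : Subgroup (Cantor ≃ₜ Cantor) :=
  Subgroup.closure (Set.range D.xx ∪ Set.range D.yy)

open PiNat

lemma cat_nil (η : Cantor) : cat [] η = η := by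
  funext n; simp [cat]

lemma cat_append (s t : List Bool) (η : Cantor) : cat (s ++ t) η = cat s (cat t η) := by
  funext n
  simp only [cat, List.length_append, List.get_eq_getElem]
  split_ifs with h₁ h₂ h₃ h₃ h₄
  · exact List.getElem_append_left h₂
  · exact List.getElem_append_right (by omega)
  · omega
  · omega
  · omega
  · congr 1; omega

lemma cat_apply_of_lt {s : List Bool} {n : ℕ} (h : n < s.length) (η : Cantor) :
    cat s η n = s[n] := by
  simp [cat, h]

lemma cat_apply_add (s : List Bool) (η : Cantor) (n : ℕ) : cat s η (s.length + n) = η n := by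
  simp [cat]

lemma cat_injective (s : List Bool) : Function.Injective (cat s) := by
  intro η η' h
  funext n
  rw [← cat_apply_add s η n, h, cat_apply_add]

lemma exists_eq_cat_singleton (ξ : Cantor) : ∃ b η, ξ = cat [b] η := by
  refine ⟨ξ 0, fun n => ξ (n + 1), ?_⟩
  funext n
  cases n <;> simp [cat]

/-- The constant sequence `b b b …`. -/
def constSeq (b : Bool) : Cantor := fun _ => b

lemma cat_constSeq (s : List Bool) (b : Bool) (h : ∀ a ∈ s, a = b) :
    cat s (constSeq b) = constSeq b := by
  funext n
  by_cases hn : n < s.length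
  · rw [cat_apply_of_lt hn]; exact h _ (List.getElem_mem hn)
  · simp [cat, hn, constSeq]

lemma eq_constSeq_of_eq_cat {s : List Bool} (hs : s ≠ []) {b : Bool} (h : ∀ a ∈ s, a = b)
    {ξ : Cantor} (hξ : ξ = cat s ξ) : ξ = constSeq b := by
  have hpos : 0 < s.length := List.length_pos_iff.2 hs
  funext n
  induction n using Nat.strong_induction_on with
  | _ n ih =>
    rw [hξ]
    by_cases hn : n < s.length
    · rw [cat_apply_of_lt hn]; exact h _ (List.getElem_mem hn)
    · simpa [cat, hn, constSeq] using ih (n - s.length) (by omega)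

lemma firstDiff_cat {s : List Bool} {η η' : Cantor} (h : η ≠ η') :
    firstDiff (cat s η) (cat s η') = s.length + firstDiff η η' := by
  have hc : cat s η ≠ cat s η' := fun e => h (cat_injective s e)
  apply le_antisymm
  · by_contra! hlt
    have := apply_eq_of_lt_firstDiff hlt
    rw [cat_apply_add, cat_apply_add] at this
    exact apply_firstDiff_ne h this
  · by_contra! hlt
    refine apply_firstDiff_ne hc ?_
    generalize firstDiff (cat s η) (cat s η') = m at hlt
    by_cases hm : m < s.length
    · rw [cat_apply_of_lt hm, cat_apply_of_lt hm]
    · obtain ⟨j, rfl⟩ := Nat.exists_eq_add_of_le (not_lt.1 hm)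
      rw [cat_apply_add, cat_apply_add]
      exact apply_eq_of_lt_firstDiff (by omega)

lemma firstDiff_cat_singleton_of_ne {a b : Bool} (h : a ≠ b) (η η' : Cantor) :
    firstDiff (cat [a] η) (cat [b] η') = 0 := by
  by_contra hne
  exact h (by simpa [cat] using apply_eq_of_lt_firstDiff (Nat.pos_of_ne_zero hne))

lemma firstDiff_cat_le_of_not_isPrefixOf {s : List Bool} {ζ : Cantor} (h : ¬ IsPrefixOf s ζ)
    (η : Cantor) : firstDiff (cat s η) ζ ≤ s.length := by
  by_contra! hlt
  refine h ⟨fun n => ζ (s.length + n), ?_⟩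
  funext n
  by_cases hn : n < s.length
  · rw [cat_apply_of_lt hn, ← apply_eq_of_lt_firstDiff (hn.trans hlt), cat_apply_of_lt hn]
  · obtain ⟨j, rfl⟩ := Nat.exists_eq_add_of_le (not_lt.1 hn)
    rw [cat_apply_add]

/-- `f` multiplies the length of the common prefix with `ξ` by `2 ^ k`, up to a bounded error. -/
def ScalesAt (f : Cantor ≃ₜ Cantor) (k : ℤ) (ξ : Cantor) : Prop :=
  ∃ C : ℝ, ∀ ζ, |(firstDiff (f ξ) (f ζ) : ℝ) - 2 ^ k * firstDiff ξ ζ| ≤ C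

lemma exists_firstDiff_eq (ξ : Cantor) (n : ℕ) : ∃ ζ, firstDiff ξ ζ = n := by
  refine ⟨Function.update ξ n (!ξ n), le_antisymm ?_ ?_⟩
  · by_contra! hlt
    simpa using apply_eq_of_lt_firstDiff hlt
  · have hne : ξ ≠ Function.update ξ n (!ξ n) := fun e => by simpa using congrFun e n
    by_contra! hlt
    exact apply_firstDiff_ne hne (by rw [Function.update_of_ne hlt.ne])

namespace ScalesAt

variable {f g : Cantor ≃ₜ Cantor} {k l : ℤ} {ξ : Cantor}

lemma unique (hk : ScalesAt f k ξ) (hl : ScalesAt f l ξ) : k = l := by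
  obtain ⟨C, hC⟩ := hk
  obtain ⟨C', hC'⟩ := hl
  refine zpow_right_injective₀ (a := (2 : ℝ)) (by norm_num) (by norm_num) ?_
  by_contra hne
  have hpos : 0 < |(2 : ℝ) ^ k - 2 ^ l| := abs_pos.2 (sub_ne_zero.2 hne)
  obtain ⟨n, hn⟩ := exists_nat_gt ((C + C') / |(2 : ℝ) ^ k - 2 ^ l|)
  rw [div_lt_iff₀ hpos] at hn
  obtain ⟨ζ, hζ⟩ := exists_firstDiff_eq ξ n
  have h₁ := hC ζ
  have h₂ := hC' ζ
  rw [hζ] at h₁ h₂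
  have h₃ : (n : ℝ) * |(2 : ℝ) ^ k - 2 ^ l| = |((2 : ℝ) ^ k - 2 ^ l) * n| := by
    rw [abs_mul, Nat.abs_cast, mul_comm]
  have h₄ : |((2 : ℝ) ^ k - 2 ^ l) * n| ≤ C + C' := by
    rw [abs_le] at h₁ h₂ ⊢
    constructor <;> linarith [h₁.1, h₁.2, h₂.1, h₂.2]
  linarith

lemma one (ξ : Cantor) : ScalesAt 1 0 ξ := ⟨0, fun ζ => by simp⟩

lemma mul (hf : ScalesAt f k ξ) (hg : ScalesAt g l (f ξ)) : ScalesAt (g * f) (l + k) ξ := by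
  obtain ⟨C, hC⟩ := hf
  obtain ⟨C', hC'⟩ := hg
  refine ⟨C' + 2 ^ l * C, fun ζ => ?_⟩
  have h₁ := hC' (f ζ)
  have h₂ := mul_le_mul_of_nonneg_left (hC ζ) (by positivity : (0 : ℝ) ≤ 2 ^ l)
  rw [← abs_of_pos (by positivity : (0 : ℝ) < 2 ^ l), ← abs_mul,
    abs_of_pos (by positivity : (0 : ℝ) < 2 ^ l), mul_sub, ← mul_assoc,
    ← zpow_add₀ (by norm_num)] at h₂
  rw [homeo_mul_apply, homeo_mul_apply]
  rw [abs_le] at *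
  constructor <;> linarith [h₁.1, h₁.2, h₂.1, h₂.2]

lemma symm (hf : ScalesAt f k ξ) : ScalesAt f.symm (-k) (f ξ) := by
  obtain ⟨C, hC⟩ := hf
  refine ⟨2 ^ (-k) * C, fun ζ => ?_⟩
  have h₂ := mul_le_mul_of_nonneg_left (hC (f.symm ζ)) (by positivity : (0 : ℝ) ≤ 2 ^ (-k))
  rw [← abs_of_pos (by positivity : (0 : ℝ) < 2 ^ (-k)), ← abs_mul,
    abs_of_pos (by positivity : (0 : ℝ) < 2 ^ (-k)), mul_sub, ← mul_assoc,
    ← zpow_add₀ (by norm_num), neg_add_cancel, zpow_zero, one_mul, abs_sub_comm] at h₂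
  simpa using h₂

/-- The scaling exponent is unchanged when prefixes are replaced. -/
lemma of_cat {s t : List Bool} (hfg : ∀ η, f (cat s η) = cat t (g η)) {η : Cantor}
    (hg : ScalesAt g k η) : ScalesAt f k (cat s η) := by
  obtain ⟨C, hC⟩ := hg
  have hC0 : 0 ≤ C := (abs_nonneg _).trans (hC η)
  have hk : (0 : ℝ) < 2 ^ k := by positivity
  refine ⟨C + t.length + 2 ^ k * s.length, fun ζ => ?_⟩
  by_cases hζ : IsPrefixOf s ζ
  · obtain ⟨η', rfl⟩ := hζ
    by_cases hne : η = η'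
    · subst hne
      simp only [firstDiff_def, ne_eq, not_true_eq_false, dite_false]
      simp only [Nat.cast_zero, mul_zero, sub_zero, abs_zero]
      positivity
    · rw [hfg, hfg, firstDiff_cat hne, firstDiff_cat (fun e => hne (g.injective e))]
      have h₁ := hC η'
      have h₂ : (0 : ℝ) ≤ 2 ^ k * s.length := by positivity
      have h₃ : (0 : ℝ) ≤ t.length := by positivity
      push_cast
      rw [abs_le] at *
      constructor <;> linarith [h₁.1, h₁.2]
  · have hfζ : ¬ IsPrefixOf t (f ζ) := by
      rintro ⟨θ, hθ⟩
      refine hζ ⟨g.symm θ, f.injective ?_⟩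
      rw [hθ, hfg, Homeomorph.apply_symm_apply]
    have h₁ : (firstDiff (cat s η) ζ : ℝ) ≤ s.length := by
      exact_mod_cast firstDiff_cat_le_of_not_isPrefixOf hζ η
    have h₂ : (firstDiff (f (cat s η)) (f ζ) : ℝ) ≤ t.length := by
      rw [hfg]
      exact_mod_cast firstDiff_cat_le_of_not_isPrefixOf hfζ (g η)
    have h₃ := mul_le_mul_of_nonneg_left h₁ hk.le
    have h₄ : (0 : ℝ) ≤ 2 ^ k * firstDiff (cat s η) ζ := by positivity
    have h₅ : (0 : ℝ) ≤ firstDiff (f (cat s η)) (f ζ) := by positivity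
    rw [abs_le]
    constructor <;> linarith

end ScalesAt

lemma cat_cons (a : Bool) (s : List Bool) (η : Cantor) : cat (a :: s) η = cat [a] (cat s η) :=
  cat_append [a] s η

lemma cat_singleton_inj {a b : Bool} {η η' : Cantor} :
    cat [a] η = cat [b] η' ↔ a = b ∧ η = η' := by
  refine ⟨fun h => ?_, fun ⟨h, h'⟩ => h ▸ h' ▸ rfl⟩
  have hab : a = b := by simpa [cat] using congrFun h 0
  subst hab
  exact ⟨rfl, cat_injective _ h⟩

lemma cat_singleton_constSeq (b : Bool) : cat [b] (constSeq b) = constSeq b :=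
  cat_constSeq _ _ (by simp)

/-- The left endpoints of the gaps of the Cantor set, seen inside the circle: `some u` is the gap
between `u 0 1 1 1 …` and `u 1 0 0 0 …`, and `none` that between `1 1 1 …` and `0 0 0 …`. -/
def gapLeft : Option (List Bool) → Cantor
  | none => constSeq true
  | some u => cat u (cat [false] (constSeq true))

/-- The right endpoints of the gaps of the Cantor set, indexed as in `gapLeft`. -/
def gapRight : Option (List Bool) → Cantor
  | none => constSeq false
  | some u => cat u (cat [true] (constSeq false))

lemma gapLeft_append (s u : List Bool) : gapLeft (some (s ++ u)) = cat s (gapLeft (some u)) :=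
  cat_append ..

lemma gapRight_append (s u : List Bool) : gapRight (some (s ++ u)) = cat s (gapRight (some u)) :=
  cat_append ..

lemma gapLeft_cons (a : Bool) (u : List Bool) :
    gapLeft (some (a :: u)) = cat [a] (gapLeft (some u)) :=
  gapLeft_append [a] u

lemma gapRight_cons (a : Bool) (u : List Bool) :
    gapRight (some (a :: u)) = cat [a] (gapRight (some u)) :=
  gapRight_append [a] u

lemma gapLeft_some_ne_constSeq (u : List Bool) : gapLeft (some u) ≠ constSeq true := by
  intro h
  simpa [gapLeft, cat, constSeq] using congrFun h u.length

lemma gapLeft_injective : Function.Injective gapLeft := by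
  have key : ∀ u v, gapLeft (some u) = gapLeft (some v) → u = v := by
    intro u
    induction u with
    | nil =>
      rintro (_ | ⟨b, v⟩) h
      · rfl
      · rw [gapLeft_cons, gapLeft, cat_nil, cat_singleton_inj] at h
        exact absurd h.2.symm (gapLeft_some_ne_constSeq v)
    | cons a u ih =>
      rintro (_ | ⟨b, v⟩) h
      · rw [gapLeft_cons, gapLeft.eq_2 [], cat_nil, cat_singleton_inj] at h
        exact absurd h.2 (gapLeft_some_ne_constSeq u)
      · rw [gapLeft_cons, gapLeft_cons, cat_singleton_inj] at h
        rw [h.1, ih v h.2]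
  rintro (_ | u) (_ | v) h
  · rfl
  · exact absurd h.symm (gapLeft_some_ne_constSeq v)
  · exact absurd h (gapLeft_some_ne_constSeq u)
  · rw [key u v h]

/-- `f` maps the endpoints of the gap `i` to those of the gap `j`. -/
def MapsGap (f : Cantor ≃ₜ Cantor) (i j : Option (List Bool)) : Prop :=
  f (gapLeft i) = gapLeft j ∧ f (gapRight i) = gapRight j

lemma MapsGap.symm {f : Cantor ≃ₜ Cantor} {i j : Option (List Bool)} (h : MapsGap f i j) :
    MapsGap f.symm j i := by
  rw [MapsGap, ← h.1, ← h.2]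
  simp

lemma MapsGap.of_cat {f g : Cantor ≃ₜ Cantor} {s t u v : List Bool}
    (hfg : ∀ η, f (cat s η) = cat t (g η)) (h : MapsGap g (some u) (some v)) :
    MapsGap f (some (s ++ u)) (some (t ++ v)) := by
  simp only [MapsGap, gapLeft_append, gapRight_append, hfg, h.1, h.2, and_self]

lemma MapsGap.one (i : Option (List Bool)) : MapsGap 1 i i := ⟨rfl, rfl⟩

/-- `f` permutes the gaps, and `v` is the sum over all gaps of the difference of the scaling
exponents of `f` at the left and at the right endpoint. -/
def HasJump (f : Cantor ≃ₜ Cantor) (v : ℤ) : Prop :=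
  ∃ (σ : Equiv.Perm (Option (List Bool))) (c : Option (List Bool) →₀ ℤ),
    (∀ i, MapsGap f i (σ i)) ∧
    (∀ i, ∃ k, ScalesAt f (k + c i) (gapLeft i) ∧ ScalesAt f k (gapRight i)) ∧
    c.degree = v

namespace HasJump

variable {f g : Cantor ≃ₜ Cantor} {v w : ℤ}

lemma unique (hv : HasJump f v) (hw : HasJump f w) : v = w := by
  obtain ⟨-, c, -, hc, rfl⟩ := hv
  obtain ⟨-, d, -, hd, rfl⟩ := hw
  congr 1
  ext i
  obtain ⟨k, hk, hk'⟩ := hc i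
  obtain ⟨l, hl, hl'⟩ := hd i
  have h₁ := hk.unique hl
  have h₂ := hk'.unique hl'
  omega

lemma one : HasJump 1 0 :=
  ⟨1, 0, MapsGap.one, fun _ => ⟨0, ScalesAt.one _, ScalesAt.one _⟩, map_zero _⟩

lemma mul (hf : HasJump f v) (hg : HasJump g w) : HasJump (g * f) (w + v) := by
  obtain ⟨σ, c, hσ, hc, rfl⟩ := hf
  obtain ⟨τ, d, hτ, hd, rfl⟩ := hg
  refine ⟨τ * σ, d.mapDomain σ.symm + c, fun i => ⟨?_, ?_⟩, fun i => ?_, ?_⟩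
  · rw [homeo_mul_apply, (hσ i).1, (hτ _).1]; rfl
  · rw [homeo_mul_apply, (hσ i).2, (hτ _).2]; rfl
  · obtain ⟨k, hk, hk'⟩ := hc i
    obtain ⟨l, hl, hl'⟩ := hd (σ i)
    rw [← (hσ i).1] at hl
    rw [← (hσ i).2] at hl'
    refine ⟨l + k, ?_, hk'.mul hl'⟩
    convert hk.mul hl using 1
    rw [Finsupp.add_apply, Finsupp.mapDomain_equiv_apply, Equiv.symm_symm]
    ring
  · rw [map_add, Finsupp.degree_mapDomain]

lemma inv (hf : HasJump f v) : HasJump f⁻¹ (-v) := by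
  obtain ⟨σ, c, hσ, hc, rfl⟩ := hf
  refine ⟨σ⁻¹, (-c).mapDomain σ, fun i => ?_, fun i => ?_, ?_⟩
  · have := (hσ (σ⁻¹ i)).symm
    rwa [← Equiv.Perm.mul_apply, mul_inv_cancel] at this
  · obtain ⟨j, rfl⟩ := σ.surjective i
    obtain ⟨k, hk, hk'⟩ := hc j
    have h₁ := hk.symm
    have h₂ := hk'.symm
    rw [(hσ j).1] at h₁
    rw [(hσ j).2] at h₂
    refine ⟨-k, ?_, h₂⟩
    have e : -k + (-c).mapDomain σ (σ j) = -(k + c j) := by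
      rw [Finsupp.mapDomain_equiv_apply, Equiv.symm_apply_apply, Finsupp.neg_apply]
      ring
    exact e ▸ h₁
  · rw [Finsupp.degree_mapDomain, map_neg]

lemma of_surjective (c : Option (List Bool) →₀ ℤ) (hmap : ∀ i, ∃ j, MapsGap f i j)
    (hsurj : ∀ j, ∃ i, MapsGap f i j)
    (hc : ∀ i, ∃ k, ScalesAt f (k + c i) (gapLeft i) ∧ ScalesAt f k (gapRight i)) :
    HasJump f c.degree := by
  choose σ hσ using hmap
  refine ⟨Equiv.ofBijective σ ⟨fun i j h => ?_, fun j => ?_⟩, c, hσ, hc, rfl⟩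
  · apply gapLeft_injective
    apply f.injective
    rw [(hσ i).1, (hσ j).1, h]
  · obtain ⟨i, hi⟩ := hsurj j
    refine ⟨i, gapLeft_injective ?_⟩
    rw [← (hσ i).1, hi.1]

end HasJump

/-- `f` fixes the constant sequences with scaling exponents `-a` and `b`, permutes the remaining
gaps, and `v` is the total jump of the scaling exponent over these gaps. -/
structure HasInnerJump (f : Cantor ≃ₜ Cantor) (a b v : ℤ) : Prop where
  map_constSeq : ∀ d, f (constSeq d) = constSeq d
  scalesAt_false : ScalesAt f (-a) (constSeq false)
  scalesAt_true : ScalesAt f b (constSeq true)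
  surj : ∀ u', ∃ u, MapsGap f (some u) (some u')
  jump : ∃ c : List Bool →₀ ℤ, c.degree = v ∧ ∀ u, (∃ u', MapsGap f (some u) (some u')) ∧
    ∃ k, ScalesAt f (k + c u) (gapLeft (some u)) ∧ ScalesAt f k (gapRight (some u))

namespace HasInnerJump

variable {f f' : Cantor ≃ₜ Cantor} {a b v : ℤ}

lemma hasJump (h : HasInnerJump f a b v) : HasJump f (a + b + v) := by
  obtain ⟨c, rfl, hc⟩ := h.jump
  have hsome (u : List Bool) :
      (Finsupp.single none (a + b) + c.mapDomain some : Option (List Bool) →₀ ℤ) (some u) = c u := by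
    simp [Finsupp.mapDomain_apply (Option.some_injective _)]
  have hnone :
      (Finsupp.single none (a + b) + c.mapDomain some : Option (List Bool) →₀ ℤ) none = a + b := by
    simp [Finsupp.mapDomain_of_notMem_range]
  have hMaps : MapsGap f none none := ⟨h.map_constSeq _, h.map_constSeq _⟩
  have key := HasJump.of_surjective (f := f) (Finsupp.single none (a + b) + c.mapDomain some)
    (by
      rintro (_ | u)
      · exact ⟨_, hMaps⟩
      · obtain ⟨u', hu⟩ := (hc u).1
        exact ⟨_, hu⟩)
    (by
      rintro (_ | u)
      · exact ⟨_, hMaps⟩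
      · obtain ⟨u', hu⟩ := h.surj u
        exact ⟨_, hu⟩)
    (by
      rintro (_ | u)
      · refine ⟨-a, ?_, h.scalesAt_false⟩
        rw [hnone, neg_add_cancel_left]
        exact h.scalesAt_true
      · rw [hsome]
        exact (hc u).2)
  rwa [map_add, Finsupp.degree_single, Finsupp.degree_mapDomain] at key

lemma mapsGap_nil {f g h : Cantor ≃ₜ Cantor} (hf : ∀ η, f (cat [false] η) = cat [false] (g η))
    (hf' : ∀ η, f (cat [true] η) = cat [true] (h η)) (hg : g (constSeq true) = constSeq true)
    (hh : h (constSeq false) = constSeq false) : MapsGap f (some []) (some []) := by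
  simp only [MapsGap, gapLeft, gapRight, cat_nil, hf, hf', hg, hh, and_self]

lemma map_constSeq_of_cat {f g h : Cantor ≃ₜ Cantor}
    (hf : ∀ η, f (cat [false] η) = cat [false] (g η))
    (hf' : ∀ η, f (cat [true] η) = cat [true] (h η)) (hg : g (constSeq false) = constSeq false)
    (hh : h (constSeq true) = constSeq true) (d : Bool) : f (constSeq d) = constSeq d := by
  rw [← cat_singleton_constSeq d]
  cases d
  · rw [hf, hg]
  · rw [hf', hh]

lemma extend_false (h : HasInnerJump f a b v)
    (hf : ∀ η, f' (cat [false] η) = cat [false] (f η))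
    (hf' : ∀ η, f' (cat [true] η) = cat [true] ((1 : Cantor ≃ₜ Cantor) η)) :
    HasInnerJump f' a 0 (b + v) where
  map_constSeq := map_constSeq_of_cat hf hf' (h.map_constSeq _) rfl
  scalesAt_false := by
    rw [← cat_singleton_constSeq]
    exact h.scalesAt_false.of_cat hf
  scalesAt_true := by
    rw [← cat_singleton_constSeq]
    exact (ScalesAt.one _).of_cat hf'
  surj := by
    rintro (_ | ⟨_ | _, u⟩)
    · exact ⟨_, mapsGap_nil hf hf' (h.map_constSeq _) rfl⟩
    · obtain ⟨w, hw⟩ := h.surj u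
      exact ⟨_, hw.of_cat hf⟩
    · exact ⟨_, (MapsGap.one (some u)).of_cat hf'⟩
  jump := by
    obtain ⟨c, rfl, hc⟩ := h.jump
    refine ⟨Finsupp.single [] b + c.mapDomain (List.cons false), ?_, ?_⟩
    · rw [map_add, Finsupp.degree_single, Finsupp.degree_mapDomain]
    rintro (_ | ⟨_ | _, u⟩)
    · refine ⟨⟨_, mapsGap_nil hf hf' (h.map_constSeq _) rfl⟩, 0, ?_, ?_⟩
      · simpa [Finsupp.mapDomain_of_notMem_range, gapLeft, cat_nil] using h.scalesAt_true.of_cat hf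
      · simpa [gapRight, cat_nil] using (ScalesAt.one _).of_cat hf'
    · obtain ⟨⟨w, hw⟩, k, hk, hk'⟩ := hc u
      refine ⟨⟨_, hw.of_cat hf⟩, k, ?_, ?_⟩
      · rw [Finsupp.add_apply, Finsupp.mapDomain_apply List.cons_injective]
        simpa using (gapLeft_cons false u) ▸ hk.of_cat hf
      · exact (gapRight_cons false u) ▸ hk'.of_cat hf
    · refine ⟨⟨_, (MapsGap.one (some u)).of_cat hf'⟩, 0, ?_, ?_⟩
      · simpa [Finsupp.mapDomain_of_notMem_range] using
          (gapLeft_cons true u) ▸ (ScalesAt.one _).of_cat hf'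
      · exact (gapRight_cons true u) ▸ (ScalesAt.one _).of_cat hf'

lemma extend_true (h : HasInnerJump f a b v)
    (hf : ∀ η, f' (cat [false] η) = cat [false] ((1 : Cantor ≃ₜ Cantor) η))
    (hf' : ∀ η, f' (cat [true] η) = cat [true] (f η)) :
    HasInnerJump f' 0 b (a + v) where
  map_constSeq := map_constSeq_of_cat hf hf' rfl (h.map_constSeq _)
  scalesAt_false := by
    rw [← cat_singleton_constSeq]
    exact (ScalesAt.one _).of_cat hf
  scalesAt_true := by
    rw [← cat_singleton_constSeq]
    exact h.scalesAt_true.of_cat hf'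
  surj := by
    rintro (_ | ⟨_ | _, u⟩)
    · exact ⟨_, mapsGap_nil hf hf' rfl (h.map_constSeq _)⟩
    · exact ⟨_, (MapsGap.one (some u)).of_cat hf⟩
    · obtain ⟨w, hw⟩ := h.surj u
      exact ⟨_, hw.of_cat hf'⟩
  jump := by
    obtain ⟨c, rfl, hc⟩ := h.jump
    refine ⟨Finsupp.single [] a + c.mapDomain (List.cons true), ?_, ?_⟩
    · rw [map_add, Finsupp.degree_single, Finsupp.degree_mapDomain]
    rintro (_ | ⟨_ | _, u⟩)
    · refine ⟨⟨_, mapsGap_nil hf hf' rfl (h.map_constSeq _)⟩, -a, ?_, ?_⟩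
      · simpa [Finsupp.mapDomain_of_notMem_range, gapLeft, cat_nil] using (ScalesAt.one _).of_cat hf
      · simpa [gapRight, cat_nil] using h.scalesAt_false.of_cat hf'
    · refine ⟨⟨_, (MapsGap.one (some u)).of_cat hf⟩, 0, ?_, ?_⟩
      · simpa [Finsupp.mapDomain_of_notMem_range] using
          (gapLeft_cons false u) ▸ (ScalesAt.one _).of_cat hf
      · exact (gapRight_cons false u) ▸ (ScalesAt.one _).of_cat hf
    · obtain ⟨⟨w, hw⟩, k, hk, hk'⟩ := hc u
      refine ⟨⟨_, hw.of_cat hf'⟩, k, ?_, ?_⟩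
      · rw [Finsupp.add_apply, Finsupp.mapDomain_apply List.cons_injective]
        simpa using (gapLeft_cons true u) ▸ hk.of_cat hf'
      · exact (gapRight_cons true u) ▸ hk'.of_cat hf'

end HasInnerJump

/-- If `F s` acts as `f` below `s` and trivially elsewhere, its total jump is that of `f`. -/
lemma HasInnerJump.hasJump_cone {f : Cantor ≃ₜ Cantor} {F : List Bool → Cantor ≃ₜ Cantor}
    {a b v : ℤ} (h : HasInnerJump f a b v) (hF : ∀ s η, F s (cat s η) = cat s (f η))
    (hF' : ∀ s ξ, ¬ IsPrefixOf s ξ → F s ξ = ξ) (s : List Bool) :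
    HasJump (F s) (a + b + v) := by
  suffices H : ∃ a' b' v', a' + b' + v' = a + b + v ∧ HasInnerJump (F s) a' b' v' by
    obtain ⟨a', b', v', e, H⟩ := H
    exact e ▸ H.hasJump
  have hsame (d : Bool) (s : List Bool) (η : Cantor) :
      F (d :: s) (cat [d] η) = cat [d] (F s η) := by
    by_cases hp : IsPrefixOf s η
    · obtain ⟨θ, rfl⟩ := hp
      rw [← cat_cons, hF, hF, cat_cons]
    · rw [hF' s η hp, hF']
      rintro ⟨θ, hθ⟩
      rw [cat_cons d s] at hθ
      exact hp ⟨θ, cat_injective _ hθ⟩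
  have hdiff (d e : Bool) (hde : e ≠ d) (s : List Bool) (η : Cantor) :
      F (d :: s) (cat [e] η) = cat [e] ((1 : Cantor ≃ₜ Cantor) η) := by
    refine hF' _ _ ?_
    rintro ⟨θ, hθ⟩
    rw [cat_cons d s, cat_singleton_inj] at hθ
    exact hde hθ.1
  induction s with
  | nil =>
    have : F [] = f := Homeomorph.ext fun ξ => by simpa [cat_nil] using hF [] ξ
    exact ⟨a, b, v, rfl, this ▸ h⟩
  | cons d s ih =>
    obtain ⟨a', b', v', e, ih⟩ := ih
    cases d
    · exact ⟨_, _, _, by omega, ih.extend_false (hsame _ s) (hdiff _ _ (by simp) s)⟩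
    · exact ⟨_, _, _, by omega, ih.extend_true (hdiff _ _ (by simp) s) (hsame _ s)⟩

/-- `f` maps the gap `some u` to a gap `some u'`, with equal scaling exponents at its endpoints. -/
def IsSmoothAt (f : Cantor ≃ₜ Cantor) (u : List Bool) : Prop :=
  ∃ u' k, MapsGap f (some u) (some u') ∧
    ScalesAt f k (gapLeft (some u)) ∧ ScalesAt f k (gapRight (some u))

lemma IsSmoothAt.one (u : List Bool) : IsSmoothAt 1 u :=
  ⟨u, 0, MapsGap.one _, ScalesAt.one _, ScalesAt.one _⟩

lemma IsSmoothAt.of_cat {f g : Cantor ≃ₜ Cantor} {s t u : List Bool}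
    (hfg : ∀ η, f (cat s η) = cat t (g η)) (h : IsSmoothAt g u) : IsSmoothAt f (s ++ u) := by
  obtain ⟨u', k, hu, hl, hr⟩ := h
  exact ⟨_, k, hu.of_cat hfg, gapLeft_append s u ▸ hl.of_cat hfg,
    gapRight_append s u ▸ hr.of_cat hfg⟩

/-- `f` fixes the constant sequences with opposite scaling exponents `-a` and `a`. -/
structure FixesEnds (f : Cantor ≃ₜ Cantor) (a : ℤ) : Prop where
  map_constSeq : ∀ d, f (constSeq d) = constSeq d
  scalesAt_false : ScalesAt f (-a) (constSeq false)
  scalesAt_true : ScalesAt f a (constSeq true)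

lemma FixesEnds.one : FixesEnds 1 0 := ⟨fun _ => rfl, ScalesAt.one _, ScalesAt.one _⟩

lemma FixesEnds.symm {f : Cantor ≃ₜ Cantor} {a : ℤ} (h : FixesEnds f a) :
    FixesEnds f.symm (-a) where
  map_constSeq d := by rw [Homeomorph.symm_apply_eq, h.map_constSeq]
  scalesAt_false := h.map_constSeq false ▸ h.scalesAt_false.symm
  scalesAt_true := h.map_constSeq true ▸ h.scalesAt_true.symm

/-- The case of a gap whose endpoints are the extreme points below two adjacent prefixes `s₁`, `s₂`
on which `f` acts by different prefix replacements. -/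
lemma IsSmoothAt.of_halves {f g h : Cantor ≃ₜ Cantor} {s₁ s₂ t₁ t₂ u u' : List Bool} {k : ℤ}
    (h₁ : ∀ η, f (cat s₁ η) = cat t₁ (g η)) (h₂ : ∀ η, f (cat s₂ η) = cat t₂ (h η))
    (hs₁ : gapLeft (some u) = cat s₁ (constSeq true))
    (hs₂ : gapRight (some u) = cat s₂ (constSeq false))
    (ht₁ : gapLeft (some u') = cat t₁ (constSeq true))
    (ht₂ : gapRight (some u') = cat t₂ (constSeq false))
    (hg : g (constSeq true) = constSeq true) (hh : h (constSeq false) = constSeq false)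
    (hgk : ScalesAt g k (constSeq true)) (hhk : ScalesAt h k (constSeq false)) :
    IsSmoothAt f u :=
  ⟨u', k, ⟨by rw [hs₁, h₁, hg, ht₁], by rw [hs₂, h₂, hh, ht₂]⟩, hs₁ ▸ hgk.of_cat h₁,
    hs₂ ▸ hhk.of_cat h₂⟩

lemma gapLeft_eq_cat (u : List Bool) (n : ℕ) :
    gapLeft (some u) = cat (u ++ false :: List.replicate n true) (constSeq true) := by
  rw [cat_append, cat_cons, cat_constSeq _ _ (by simp)]; rfl

lemma gapRight_eq_cat (u : List Bool) (n : ℕ) :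
    gapRight (some u) = cat (u ++ true :: List.replicate n false) (constSeq false) := by
  rw [cat_append, cat_cons, cat_constSeq _ _ (by simp)]; rfl

section Branching

variable {f g h : Cantor ≃ₜ Cantor} {a : ℤ}

lemma isSmoothAt_of_expand (h00 : ∀ η, f (cat [false, false] η) = cat [false] (g η))
    (h01 : ∀ η, f (cat [false, true] η) = cat [true, false] (h η))
    (h1 : ∀ η, f (cat [true] η) = cat [true, true] (g η))
    (hg : FixesEnds g a) (hh : FixesEnds h (-a)) (u : List Bool)
    (ihg : ∀ w : List Bool, w.length < u.length → IsSmoothAt g w)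
    (ihh : ∀ w : List Bool, w.length < u.length → IsSmoothAt h w) : IsSmoothAt f u := by
  have hh' := hh.scalesAt_false
  rw [neg_neg] at hh'
  match u with
  | [] =>
    exact .of_halves (u' := [true]) h01 h1 (gapLeft_eq_cat _ 1) (gapRight_eq_cat _ 0)
      (gapLeft_eq_cat _ 0) (gapRight_eq_cat _ 0) (hh.map_constSeq _) (hg.map_constSeq _)
      hh.scalesAt_true hg.scalesAt_false
  | [false] =>
    exact .of_halves (u' := []) h00 h01 (gapLeft_eq_cat _ 0) (gapRight_eq_cat _ 0)
      (gapLeft_eq_cat _ 0) (gapRight_eq_cat _ 1) (hg.map_constSeq _) (hh.map_constSeq _)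
      hg.scalesAt_true hh'
  | false :: false :: w => exact (ihg w (by simp)).of_cat h00
  | false :: true :: w => exact (ihh w (by simp)).of_cat h01
  | true :: w => exact (ihg w (by simp)).of_cat h1

lemma isSmoothAt_of_contract (h0 : ∀ η, f (cat [false] η) = cat [false, false] (g η))
    (h10 : ∀ η, f (cat [true, false] η) = cat [false, true] (h η))
    (h11 : ∀ η, f (cat [true, true] η) = cat [true] (g η))
    (hg : FixesEnds g a) (hh : FixesEnds h (-a)) (u : List Bool)
    (ihg : ∀ w : List Bool, w.length < u.length → IsSmoothAt g w)
    (ihh : ∀ w : List Bool, w.length < u.length → IsSmoothAt h w) : IsSmoothAt f u := by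
  have hh' := hh.scalesAt_false
  rw [neg_neg] at hh'
  match u with
  | [] =>
    exact .of_halves (u' := [false]) h0 h10 (gapLeft_eq_cat _ 0) (gapRight_eq_cat _ 1)
      (gapLeft_eq_cat _ 0) (gapRight_eq_cat _ 0) (hg.map_constSeq _) (hh.map_constSeq _)
      hg.scalesAt_true hh'
  | [true] =>
    exact .of_halves (u' := []) h10 h11 (gapLeft_eq_cat _ 0) (gapRight_eq_cat _ 0)
      (gapLeft_eq_cat _ 1) (gapRight_eq_cat _ 0) (hh.map_constSeq _) (hg.map_constSeq _)
      hh.scalesAt_true hg.scalesAt_false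
  | true :: true :: w => exact (ihg w (by simp)).of_cat h11
  | true :: false :: w => exact (ihh w (by simp)).of_cat h10
  | false :: w => exact (ihg w (by simp)).of_cat h0

end Branching

lemma HasInnerJump.of_isSmoothAt {f : Cantor ≃ₜ Cantor} {a : ℤ} (h : FixesEnds f a)
    (hf : ∀ u, IsSmoothAt f u) (hf' : ∀ u, IsSmoothAt f.symm u) : HasInnerJump f a a 0 where
  map_constSeq := h.map_constSeq
  scalesAt_false := h.scalesAt_false
  scalesAt_true := h.scalesAt_true
  surj u := by
    obtain ⟨u', -, hu, -⟩ := hf' u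
    exact ⟨u', hu.symm⟩
  jump := by
    refine ⟨0, map_zero _, fun u => ?_⟩
    obtain ⟨u', k, hu, hl, hr⟩ := hf u
    exact ⟨⟨u', hu⟩, k, by simpa using hl, hr⟩

lemma symm_apply_of_cat {f g : Cantor ≃ₜ Cantor} {s t : List Bool}
    (hfg : ∀ η, f (cat s η) = cat t (g η)) (η : Cantor) :
    f.symm (cat t η) = cat s (g.symm η) := by
  rw [Homeomorph.symm_apply_eq, hfg, Homeomorph.apply_symm_apply]

lemma firstDiff_constSeq_cat_same (d : Bool) {η : Cantor} (h : constSeq d ≠ η) :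
    firstDiff (constSeq d) (cat [d] η) = 1 + firstDiff (constSeq d) η := by
  conv_lhs => rw [← cat_singleton_constSeq d]
  rw [firstDiff_cat h]
  rfl

lemma firstDiff_constSeq_cat_of_ne {d e : Bool} (h : d ≠ e) (η : Cantor) :
    firstDiff (constSeq d) (cat [e] η) = 0 := by
  rw [← cat_singleton_constSeq d, firstDiff_cat_singleton_of_ne h]

lemma firstDiff_self (ξ : Cantor) : firstDiff ξ ξ = 0 := by
  simp [firstDiff_def]

lemma constSeq_ne_of_ne_cat {d : Bool} {η : Cantor} (h : constSeq d ≠ cat [d] η) :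
    constSeq d ≠ η := by
  rintro rfl
  exact h (cat_singleton_constSeq d).symm

lemma exists_eq_cat_replicate (n : ℕ) (ξ : Cantor) :
    (∃ k ≤ n, ∃ η, ξ = cat (List.replicate k true ++ [false]) η) ∨
      ∃ η, ξ = cat (List.replicate (n + 1) true) η := by
  induction n generalizing ξ with
  | zero =>
    obtain ⟨_ | _, η, rfl⟩ := exists_eq_cat_singleton ξ
    · exact .inl ⟨0, le_rfl, η, rfl⟩
    · exact .inr ⟨η, rfl⟩
  | succ n ih =>
    obtain ⟨_ | _, η, rfl⟩ := exists_eq_cat_singleton ξ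
    · exact .inl ⟨0, by omega, η, rfl⟩
    · obtain ⟨k, hk, θ, rfl⟩ | ⟨θ, rfl⟩ := ih η
      · exact .inl ⟨k + 1, by omega, θ, (cat_cons ..).symm⟩
      · exact .inr ⟨θ, (cat_cons ..).symm⟩

lemma list_eq_replicate_append (n : ℕ) (u : List Bool) :
    (∃ k ≤ n, ∃ w, u = List.replicate k true ++ [false] ++ w) ∨
      (∃ w, u = List.replicate (n + 1) true ++ w) ∨ ∃ k ≤ n, u = List.replicate k true := by
  induction n generalizing u with
  | zero =>
    match u with
    | [] => exact .inr (.inr ⟨0, le_rfl, rfl⟩)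
    | false :: w => exact .inl ⟨0, le_rfl, w, rfl⟩
    | true :: w => exact .inr (.inl ⟨w, rfl⟩)
  | succ n ih =>
    match u with
    | [] => exact .inr (.inr ⟨0, by omega, rfl⟩)
    | false :: w => exact .inl ⟨0, by omega, w, rfl⟩
    | true :: w =>
      obtain ⟨k, hk, w, rfl⟩ | ⟨w, rfl⟩ | ⟨k, hk, rfl⟩ := ih w
      · exact .inl ⟨k + 1, by omega, w, rfl⟩
      · exact .inr (.inl ⟨w, rfl⟩)
      · exact .inr (.inr ⟨k + 1, by omega, rfl⟩)

namespace LMData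

variable (D : LMData)

lemma hasInnerJump_x : HasInnerJump D.x 0 0 0 := by
  have h00 : ∀ η, D.x (cat [false, false] η) = cat [false] ((1 : Cantor ≃ₜ Cantor) η) := D.hx00
  have h01 : ∀ η, D.x (cat [false, true] η) = cat [true, false] ((1 : Cantor ≃ₜ Cantor) η) :=
    D.hx01
  have h1 : ∀ η, D.x (cat [true] η) = cat [true, true] ((1 : Cantor ≃ₜ Cantor) η) := D.hx1
  have e0 : cat [false, false] (constSeq false) = constSeq false := cat_constSeq _ _ (by simp)
  have e1 : cat [true, true] (constSeq true) = constSeq true := cat_constSeq _ _ (by simp)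
  refine .of_isSmoothAt ⟨?_, ?_, ?_⟩ (fun u => ?_) (fun u => ?_)
  · rintro (_ | _)
    · conv_lhs => rw [← e0]
      rw [h00, homeo_one_apply, cat_singleton_constSeq]
    · conv_lhs => rw [← cat_singleton_constSeq]
      rw [h1, homeo_one_apply, e1]
  · rw [← e0]
    exact (ScalesAt.one _).of_cat h00
  · rw [← cat_singleton_constSeq]
    exact (ScalesAt.one _).of_cat h1
  · exact isSmoothAt_of_expand h00 h01 h1 .one .one u (fun w _ => .one w) (fun w _ => .one w)
  · exact isSmoothAt_of_contract (symm_apply_of_cat h00) (symm_apply_of_cat h01)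
      (symm_apply_of_cat h1) FixesEnds.one.symm FixesEnds.one.symm u
      (fun w _ => .one w) (fun w _ => .one w)

lemma y_constSeq (d : Bool) : D.y (constSeq d) = constSeq d := by
  cases d
  · refine eq_constSeq_of_eq_cat (s := [false]) (by simp) (by simp) ?_
    rw [← D.hy00, cat_constSeq _ _ (by simp)]
  · refine eq_constSeq_of_eq_cat (s := [true, true]) (by simp) (by simp) ?_
    rw [← D.hy1, cat_constSeq _ _ (by simp)]

lemma constSeq_ne_y {d : Bool} {ζ : Cantor} (h : constSeq d ≠ ζ) : constSeq d ≠ D.y ζ := by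
  rw [← D.y_constSeq d]
  exact D.y.injective.ne h

lemma firstDiff_y_constSeq_false (n : ℕ) : ∀ ζ, firstDiff (constSeq false) ζ = n →
    firstDiff (constSeq false) (D.y ζ) = n / 2 := by
  induction n using Nat.strong_induction_on with
  | _ n ih =>
    rintro ζ rfl
    by_cases hζ : constSeq false = ζ
    · rw [← hζ, y_constSeq, firstDiff_self]
    obtain ⟨_ | _, η, rfl⟩ := exists_eq_cat_singleton ζ
    · have hη := constSeq_ne_of_ne_cat hζ
      rw [firstDiff_constSeq_cat_same _ hη] at ih ⊢
      obtain ⟨_ | _, θ, rfl⟩ := exists_eq_cat_singleton η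
      · have hθ := constSeq_ne_of_ne_cat hη
        rw [firstDiff_constSeq_cat_same _ hθ] at ih ⊢
        rw [← cat_cons, D.hy00, firstDiff_constSeq_cat_same _ (D.constSeq_ne_y hθ),
          ih _ (by omega) θ rfl]
        omega
      · rw [← cat_cons, D.hy01, cat_cons, firstDiff_constSeq_cat_of_ne (by simp),
          firstDiff_constSeq_cat_of_ne (by simp)]
    · rw [D.hy1, cat_cons, firstDiff_constSeq_cat_of_ne (by simp),
        firstDiff_constSeq_cat_of_ne (by simp)]

lemma firstDiff_y_constSeq_true (n : ℕ) : ∀ ζ, firstDiff (constSeq true) ζ = n →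
    2 * n ≤ firstDiff (constSeq true) (D.y ζ) ∧ firstDiff (constSeq true) (D.y ζ) ≤ 2 * n + 1 := by
  induction n using Nat.strong_induction_on with
  | _ n ih =>
    rintro ζ rfl
    by_cases hζ : constSeq true = ζ
    · simp [← hζ, y_constSeq, firstDiff_self]
    obtain ⟨_ | _, η, rfl⟩ := exists_eq_cat_singleton ζ
    · rw [firstDiff_constSeq_cat_of_ne (by simp)]
      obtain ⟨_ | _, θ, rfl⟩ := exists_eq_cat_singleton η
      · rw [← cat_cons, D.hy00, firstDiff_constSeq_cat_of_ne (by simp)]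
        omega
      · have hne : constSeq true ≠ cat [false] (D.y.symm θ) := fun e => by
          rw [← cat_singleton_constSeq, cat_singleton_inj] at e
          exact absurd e.1 (by simp)
        rw [← cat_cons, D.hy01, cat_cons true [false], firstDiff_constSeq_cat_same _ hne,
          firstDiff_constSeq_cat_of_ne (by simp)]
        omega
    · have hη := constSeq_ne_of_ne_cat hζ
      have hyη := D.constSeq_ne_y hη
      have hne : constSeq true ≠ cat [true] (D.y η) := by
        rw [← cat_singleton_constSeq]
        exact (cat_injective _).ne hyη
      rw [firstDiff_constSeq_cat_same _ hη] at ih ⊢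
      have := ih _ (by omega) η rfl
      rw [D.hy1, cat_cons true [true], firstDiff_constSeq_cat_same _ hne,
        firstDiff_constSeq_cat_same _ hyη]
      omega

lemma fixesEnds_y : FixesEnds D.y 1 where
  map_constSeq := D.y_constSeq
  scalesAt_false := by
    refine ⟨1, fun ζ => ?_⟩
    rw [y_constSeq, firstDiff_y_constSeq_false D _ ζ rfl, zpow_neg_one]
    generalize firstDiff (constSeq false) ζ = n
    have h₁ : (n : ℝ) ≤ 2 * (n / 2 : ℕ) + 1 := by norm_cast; omega
    have h₂ : 2 * ((n / 2 : ℕ) : ℝ) ≤ n := by norm_cast; omega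
    rw [abs_le]
    constructor <;> linarith
  scalesAt_true := by
    refine ⟨1, fun ζ => ?_⟩
    rw [y_constSeq, zpow_one]
    obtain ⟨h₁, h₂⟩ := firstDiff_y_constSeq_true D _ ζ rfl
    have h₁' : 2 * (firstDiff (constSeq true) ζ : ℝ) ≤ firstDiff (constSeq true) (D.y ζ) := by
      exact_mod_cast h₁
    have h₂' : (firstDiff (constSeq true) (D.y ζ) : ℝ) ≤ 2 * firstDiff (constSeq true) ζ + 1 := by
      exact_mod_cast h₂
    rw [abs_le]
    constructor <;> linarith

lemma isSmoothAt_y (u : List Bool) : IsSmoothAt D.y u ∧ IsSmoothAt D.y.symm u := by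
  induction hn : u.length using Nat.strong_induction_on generalizing u with
  | _ n ih =>
    subst hn
    have ih₁ (w : List Bool) (hw : w.length < u.length) : IsSmoothAt D.y w := (ih _ hw w rfl).1
    have ih₂ (w : List Bool) (hw : w.length < u.length) : IsSmoothAt D.y.symm w :=
      (ih _ hw w rfl).2
    exact ⟨isSmoothAt_of_expand D.hy00 D.hy01 D.hy1 D.fixesEnds_y D.fixesEnds_y.symm u ih₁ ih₂,
      isSmoothAt_of_contract (symm_apply_of_cat D.hy00) (symm_apply_of_cat D.hy01)
        (symm_apply_of_cat D.hy1) D.fixesEnds_y.symm D.fixesEnds_y u ih₂ ih₁⟩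

lemma hasInnerJump_y : HasInnerJump D.y 1 1 0 :=
  .of_isSmoothAt D.fixesEnds_y (fun u => (D.isSmoothAt_y u).1) (fun u => (D.isSmoothAt_y u).2)

lemma hasJump_xx (s : List Bool) : HasJump (D.xx s) 0 :=
  D.hasInnerJump_x.hasJump_cone D.hxx D.hxx' s

lemma hasJump_yy (s : List Bool) : HasJump (D.yy s) 2 :=
  D.hasInnerJump_y.hasJump_cone D.hyy D.hyy' s

lemma scalesAt_p (n : ℕ) (ξ : Cantor) : ScalesAt (D.p n) 0 ξ := by
  obtain ⟨k, hk, η, rfl⟩ | ⟨η, rfl⟩ := exists_eq_cat_replicate n ξ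
  · obtain rfl | hk := hk.eq_or_lt
    · exact (ScalesAt.one _).of_cat (D.hp2 k)
    · exact (ScalesAt.one _).of_cat fun η => D.hp1 n k η hk
  · exact (ScalesAt.one _).of_cat (D.hp3 n)

lemma p_cat_replicate_constSeq_false {n k : ℕ} (hk : k ≤ n) :
    D.p n (cat (List.replicate k true) (constSeq false)) =
      cat (List.replicate (k + 1) true) (constSeq false) := by
  conv_lhs => rw [← cat_singleton_constSeq, ← cat_append]
  obtain rfl | hk := hk.eq_or_lt
  · rw [D.hp2]
  · rw [D.hp1 n k _ hk, cat_append, cat_singleton_constSeq]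

lemma mapsGap_p_none (n : ℕ) : MapsGap (D.p n) none (some []) := by
  constructor
  · have e : gapLeft none = cat (List.replicate (n + 1) true) (constSeq true) :=
      (cat_constSeq _ _ (by simp)).symm
    rw [e, D.hp3, gapLeft, cat_nil]
  · simpa [cat_nil, gapRight] using D.p_cat_replicate_constSeq_false (Nat.zero_le n)

lemma mapsGap_p_last (n : ℕ) : MapsGap (D.p n) (some (List.replicate n true)) none := by
  constructor
  · rw [gapLeft.eq_2, ← cat_append, D.hp2]
    exact cat_constSeq _ _ (by simp)
  · rw [gapRight.eq_2, ← cat_append, ← List.replicate_succ', D.hp3]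
    exact cat_singleton_constSeq _

lemma mapsGap_p_replicate {n k : ℕ} (hk : k < n) :
    MapsGap (D.p n) (some (List.replicate k true)) (some (List.replicate (k + 1) true)) := by
  constructor
  · rw [gapLeft, ← cat_append, D.hp1 n k _ hk, cat_append]
    rfl
  · rw [gapRight, ← cat_append, ← List.replicate_succ', D.p_cat_replicate_constSeq_false hk,
      List.replicate_succ', cat_append]
    rfl

lemma mapsGap_p_of_lt {n k : ℕ} (hk : k < n) (w : List Bool) :
    MapsGap (D.p n) (some (List.replicate k true ++ [false] ++ w))
      (some (List.replicate (k + 1) true ++ [false] ++ w)) :=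
  (MapsGap.one _).of_cat fun η => D.hp1 n k η hk

lemma mapsGap_p_eq (n : ℕ) (w : List Bool) :
    MapsGap (D.p n) (some (List.replicate n true ++ [false] ++ w))
      (some (List.replicate (n + 1) true ++ w)) :=
  (MapsGap.one _).of_cat (D.hp2 n)

lemma mapsGap_p_wrap (n : ℕ) (w : List Bool) :
    MapsGap (D.p n) (some (List.replicate (n + 1) true ++ w)) (some ([false] ++ w)) :=
  (MapsGap.one _).of_cat (D.hp3 n)

lemma hasJump_p (n : ℕ) : HasJump (D.p n) 0 := by
  refine HasJump.of_surjective 0 ?_ ?_ fun i => ⟨0, D.scalesAt_p n _, D.scalesAt_p n _⟩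
  · rintro (_ | u)
    · exact ⟨_, D.mapsGap_p_none n⟩
    obtain ⟨k, hk, w, rfl⟩ | ⟨w, rfl⟩ | ⟨k, hk, rfl⟩ := list_eq_replicate_append n u
    · obtain rfl | hk := hk.eq_or_lt
      · exact ⟨_, D.mapsGap_p_eq k w⟩
      · exact ⟨_, D.mapsGap_p_of_lt hk w⟩
    · exact ⟨_, D.mapsGap_p_wrap n w⟩
    · obtain rfl | hk := hk.eq_or_lt
      · exact ⟨_, D.mapsGap_p_last k⟩
      · exact ⟨_, D.mapsGap_p_replicate hk⟩
  · rintro (_ | u)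
    · exact ⟨_, D.mapsGap_p_last n⟩
    obtain ⟨_ | k, hk, w, rfl⟩ | ⟨w, rfl⟩ | ⟨_ | k, hk, rfl⟩ := list_eq_replicate_append n u
    · exact ⟨_, D.mapsGap_p_wrap n w⟩
    · exact ⟨_, D.mapsGap_p_of_lt hk w⟩
    · exact ⟨_, D.mapsGap_p_eq n w⟩
    · exact ⟨_, D.mapsGap_p_none n⟩
    · exact ⟨_, D.mapsGap_p_replicate hk⟩

lemma exists_hasJump {g : Cantor ≃ₜ Cantor} (hg : g ∈ Shat D) : ∃ v, HasJump g (2 * v) := by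
  induction hg using Subgroup.closure_induction with
  | mem g hg =>
    obtain (⟨s, rfl⟩ | ⟨s, rfl⟩) | ⟨n, rfl⟩ := hg
    · exact ⟨0, D.hasJump_xx s⟩
    · exact ⟨1, D.hasJump_yy s⟩
    · exact ⟨0, D.hasJump_p n⟩
  | one => exact ⟨0, HasJump.one⟩
  | mul g h _ _ ihg ihh =>
    obtain ⟨v, hv⟩ := ihg
    obtain ⟨w, hw⟩ := ihh
    exact ⟨v + w, by simpa [mul_add] using hw.mul hv⟩
  | inv g _ ih =>
    obtain ⟨v, hv⟩ := ih
    exact ⟨-v, by simpa using hv.inv⟩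

lemma hasJump_of_mem_Tgrp {g : Cantor ≃ₜ Cantor} (hg : g ∈ Tgrp D) : HasJump g 0 := by
  induction hg using Subgroup.closure_induction with
  | mem g hg =>
    obtain ⟨s, rfl⟩ | ⟨n, rfl⟩ := hg
    · exact D.hasJump_xx s
    · exact D.hasJump_p n
  | one => exact HasJump.one
  | mul g h _ _ ihg ihh => simpa using ihh.mul ihg
  | inv g _ ih => simpa using ih.inv

end LMData

/-- there is a homomorphism `ψ̂ : Ŝ → ℤ` with `ψ̂(x_s) = 0`, `ψ̂(p_n) = 0`
and `ψ̂(y_s) = 1`; in particular Thompson's group `T` lies in its kernel. -/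
theorem statement4 (D : LMData) :
    ∃ ψ : ↥(Shat D) →* Multiplicative ℤ,
      (∀ (s : List Bool) (h : D.xx s ∈ Shat D), ψ ⟨D.xx s, h⟩ = Multiplicative.ofAdd 0) ∧
      (∀ (n : ℕ) (h : D.p n ∈ Shat D), ψ ⟨D.p n, h⟩ = Multiplicative.ofAdd 0) ∧
      (∀ (s : List Bool) (h : D.yy s ∈ Shat D), ψ ⟨D.yy s, h⟩ = Multiplicative.ofAdd 1) ∧
      (∀ (g : Cantor ≃ₜ Cantor) (hT : g ∈ Tgrp D) (h : g ∈ Shat D), ψ ⟨g, h⟩ = 1) := by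
  choose v hv using fun g : Shat D => D.exists_hasJump g.2
  have hv_eq (g : Shat D) (w : ℤ) (h : HasJump (g : Cantor ≃ₜ Cantor) (2 * w)) :
      Multiplicative.ofAdd (v g) = Multiplicative.ofAdd w := by
    have := (hv g).unique h
    exact congrArg _ (by omega)
  let ψ : Shat D →* Multiplicative ℤ := MonoidHom.mk' (fun g => Multiplicative.ofAdd (v g))
    fun g h => hv_eq _ _ (by simpa [mul_add] using (hv h).mul (hv g))
  exact ⟨ψ, fun s h => hv_eq ⟨_, h⟩ 0 (D.hasJump_xx s), fun n h => hv_eq ⟨_, h⟩ 0 (D.hasJump_p n),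
    fun s h => hv_eq ⟨_, h⟩ 1 (D.hasJump_yy s),
    fun g hT h => hv_eq ⟨_, h⟩ 0 (D.hasJump_of_mem_Tgrp hT)⟩
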